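/- Let H, N, d, d_k ∈ ℕ, B > 0, and let W_{Q,h}, W_{K,h} ∈ ℝ^{d×d_k}, W_{V,h} ∈ ℝ^{d×d} (h = 1,…,H) satisfy ‖W_{Q,h}‖_F ≤ B, ‖W_{K,h}‖_F ≤ B, ‖W_{V,h}‖_F ≤ B. Fix discard sets 𝓜_i ⊆ {1,…,i} for each row i ∈ {1,…,N}, and let mha and mha~ be the causal and lazy-masked multi-head attentions with these weights. Let X, X̃ ∈ ℝ^{N×d}, and let s = max_{i∈[N]} (1/H) Σ_{h=1}^H Σ_{j∈𝓜_i} [A_h]_{ij}, where A_h is the causal attention matrix of head h computed on LN(X̃). Then ‖mha~(LN(X̃)) − mha(LN(X))‖_{2,∞} ≤ H·B·(1 + 4B²)·min{2, ‖X − X̃‖_{2,∞}} + 2·B·H·s. -/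

import Mathlib

open scoped BigOperators
open Matrix

/-- The Euclidean (ℓ²) norm on `ℝ^d`. -/
noncomputable def l2norm {d : ℕ} (x : Fin d → ℝ) : ℝ := Real.sqrt (∑ i, x i ^ 2)

/-- The ℓ_{2,∞} norm of a matrix: the maximum ℓ² norm of its rows. -/
noncomputable def norm2inf {N d : ℕ} (X : Matrix (Fin N) (Fin d) ℝ) : ℝ :=
  ⨆ i, l2norm (X i)

/-- The Frobenius norm of a matrix. -/
noncomputable def frobNorm {m n : ℕ} (A : Matrix (Fin m) (Fin n) ℝ) : ℝ :=
  Real.sqrt (∑ i, ∑ j, A i j ^ 2)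

/-- The normalization map: `LN x = x` if `‖x‖₂ ≤ 1` and `LN x = x / ‖x‖₂` otherwise. -/
noncomputable def LN {d : ℕ} (x : Fin d → ℝ) : Fin d → ℝ :=
  if l2norm x ≤ 1 then x else (l2norm x)⁻¹ • x

/-- Row-wise application of `LN` to a matrix. -/
noncomputable def matLN {N d : ℕ} (X : Matrix (Fin N) (Fin d) ℝ) :
    Matrix (Fin N) (Fin d) ℝ :=
  Matrix.of fun i => LN (X i)

/-- The causal attention matrix of a single head. -/
noncomputable def causalAttn {N d dk : ℕ} (X : Matrix (Fin N) (Fin d) ℝ)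
    (WQ WK : Matrix (Fin d) (Fin dk) ℝ) : Matrix (Fin N) (Fin N) ℝ :=
  Matrix.of fun i j =>
    if j ≤ i then
      Real.exp ((X * WQ * (X * WK)ᵀ) i j) /
        ∑ k ∈ Finset.univ.filter (fun k : Fin N => k ≤ i),
          Real.exp ((X * WQ * (X * WK)ᵀ) i k)
    else 0

/-- Causal multi-head attention: `mha(X) = ∑_h A_h X W_{V,h}`. -/
noncomputable def mha {N d dk H : ℕ} (X : Matrix (Fin N) (Fin d) ℝ)
    (WQ WK : Fin H → Matrix (Fin d) (Fin dk) ℝ)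
    (WV : Fin H → Matrix (Fin d) (Fin d) ℝ) : Matrix (Fin N) (Fin d) ℝ :=
  ∑ h, causalAttn X (WQ h) (WK h) * X * WV h

/-- The lazy-masked attention matrix of a single head, given discard sets `M i ⊆ {0,…,i}`:
attention of row `i` is restricted to indices `j ≤ i` with `j ∉ M i` and renormalized. -/
noncomputable def lazyAttn {N d dk : ℕ} (X : Matrix (Fin N) (Fin d) ℝ)
    (WQ WK : Matrix (Fin d) (Fin dk) ℝ) (M : Fin N → Finset (Fin N)) :
    Matrix (Fin N) (Fin N) ℝ :=
  Matrix.of fun i j =>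
    if j ≤ i ∧ j ∉ M i then
      Real.exp ((X * WQ * (X * WK)ᵀ) i j) /
        ∑ k ∈ Finset.univ.filter (fun k : Fin N => k ≤ i ∧ k ∉ M i),
          Real.exp ((X * WQ * (X * WK)ᵀ) i k)
    else 0

/-- Lazy-masked causal multi-head attention. -/
noncomputable def lazyMha {N d dk H : ℕ} (X : Matrix (Fin N) (Fin d) ℝ)
    (WQ WK : Fin H → Matrix (Fin d) (Fin dk) ℝ)
    (WV : Fin H → Matrix (Fin d) (Fin d) ℝ) (M : Fin N → Finset (Fin N)) :
    Matrix (Fin N) (Fin d) ℝ :=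
  ∑ h, lazyAttn X (WQ h) (WK h) M * X * WV h

lemma l2norm_eq_norm {d : ℕ} (x : Fin d → ℝ) : l2norm x = ‖WithLp.toLp 2 x‖ := by
  simp [l2norm, EuclideanSpace.norm_eq]

lemma l2norm_nonneg {d : ℕ} (x : Fin d → ℝ) : 0 ≤ l2norm x := Real.sqrt_nonneg _

lemma l2norm_add_le {d : ℕ} (x y : Fin d → ℝ) : l2norm (x + y) ≤ l2norm x + l2norm y := by
  simp only [l2norm_eq_norm, WithLp.toLp_add]
  exact norm_add_le _ _

lemma l2norm_smul {d : ℕ} (c : ℝ) (x : Fin d → ℝ) : l2norm (c • x) = |c| * l2norm x := by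
  simp only [l2norm_eq_norm, WithLp.toLp_smul, norm_smul, Real.norm_eq_abs]

lemma l2norm_sub_le {d : ℕ} (x y : Fin d → ℝ) : l2norm (x - y) ≤ l2norm x + l2norm y := by
  simp only [l2norm_eq_norm, WithLp.toLp_sub]
  exact norm_sub_le _ _

lemma l2norm_sum_le {d : ℕ} {ι : Type*} (s : Finset ι) (f : ι → Fin d → ℝ) :
    l2norm (∑ i ∈ s, f i) ≤ ∑ i ∈ s, l2norm (f i) := by
  simp only [l2norm_eq_norm, WithLp.toLp_sum]
  exact norm_sum_le _ _

lemma l2norm_sub_comm {d : ℕ} (x y : Fin d → ℝ) : l2norm (x - y) = l2norm (y - x) := by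
  simp only [l2norm_eq_norm, WithLp.toLp_sub, norm_sub_rev]

lemma abs_dotProduct_le {d : ℕ} (x y : Fin d → ℝ) : |x ⬝ᵥ y| ≤ l2norm x * l2norm y := by
  rw [l2norm, l2norm, ← Real.sqrt_mul (Finset.sum_nonneg fun _ _ => sq_nonneg _)]
  exact Real.abs_le_sqrt (Finset.sum_mul_sq_le_sq_mul_sq _ _ _)

lemma l2norm_vecMul_le {m n : ℕ} (x : Fin m → ℝ) (W : Matrix (Fin m) (Fin n) ℝ) :
    l2norm (x ᵥ* W) ≤ l2norm x * frobNorm W := by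
  rw [l2norm, l2norm, frobNorm, ← Real.sqrt_mul (Finset.sum_nonneg fun _ _ => sq_nonneg _)]
  refine Real.sqrt_le_sqrt ?_
  rw [Finset.sum_comm (f := fun i j => W i j ^ 2), Finset.mul_sum]
  exact Finset.sum_le_sum fun j _ =>
    Finset.sum_mul_sq_le_sq_mul_sq Finset.univ x fun i => W i j

lemma l2norm_vecMul_le_of_rows {m n : ℕ} (a : Fin m → ℝ) (Y : Matrix (Fin m) (Fin n) ℝ) {r : ℝ}
    (hY : ∀ j, l2norm (Y j) ≤ r) : l2norm (a ᵥ* Y) ≤ (∑ j, |a j|) * r := by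
  rw [Matrix.vecMul_eq_sum, Finset.sum_mul]
  refine (l2norm_sum_le _ _).trans (Finset.sum_le_sum fun j _ => ?_)
  rw [l2norm_smul]
  exact mul_le_mul_of_nonneg_left (hY j) (abs_nonneg _)

lemma l2norm_row_le_norm2inf {N d : ℕ} (X : Matrix (Fin N) (Fin d) ℝ) (i : Fin N) :
    l2norm (X i) ≤ norm2inf X :=
  le_ciSup (f := fun i => l2norm (X i)) (Set.finite_range _).bddAbove i

lemma l2norm_LN_le_one {d : ℕ} (x : Fin d → ℝ) : l2norm (LN x) ≤ 1 := by
  unfold LN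
  split_ifs with h
  · exact h
  · push Not at h
    rw [l2norm_smul, abs_inv, abs_of_nonneg (l2norm_nonneg x), inv_mul_cancel₀ (by linarith)]

lemma LN_variational {d : ℕ} (x z : Fin d → ℝ) (hz : l2norm z ≤ 1) :
    0 ≤ (x - LN x) ⬝ᵥ (LN x - z) := by
  by_cases h : l2norm x ≤ 1
  · simp [LN, h]
  · have hLN : LN x = (l2norm x)⁻¹ • x := by simp [LN, h]
    push Not at h
    have hx : x = l2norm x • LN x := by
      rw [hLN, smul_smul, mul_inv_cancel₀ (by linarith), one_smul]
    have hself : LN x ⬝ᵥ LN x = 1 := by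
      have h2 : x ⬝ᵥ x = l2norm x ^ 2 := by
        rw [l2norm, Real.sq_sqrt (Finset.sum_nonneg fun _ _ => sq_nonneg _)]
        simp [dotProduct, sq]
      rw [hLN, smul_dotProduct, dotProduct_smul, h2, smul_eq_mul, smul_eq_mul]
      field_simp
    have hle : LN x ⬝ᵥ z ≤ 1 :=
      (le_abs_self _).trans <| (abs_dotProduct_le _ _).trans <|
        mul_le_one₀ (l2norm_LN_le_one x) (l2norm_nonneg z) hz
    have hsub : x - LN x = (l2norm x - 1) • LN x := by
      rw [sub_smul, one_smul, ← hx]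
    rw [hsub, smul_dotProduct, dotProduct_sub, hself, smul_eq_mul]
    exact mul_nonneg (by linarith) (by linarith)

lemma l2norm_LN_sub_LN_le {d : ℕ} (x y : Fin d → ℝ) :
    l2norm (LN x - LN y) ≤ l2norm (x - y) := by
  have h1 := LN_variational x (LN y) (l2norm_LN_le_one y)
  have h2 := LN_variational y (LN x) (l2norm_LN_le_one x)
  have h3 := (le_abs_self _).trans (abs_dotProduct_le (x - y) (LN x - LN y))
  have h4 : (LN x - LN y) ⬝ᵥ (LN x - LN y) = l2norm (LN x - LN y) ^ 2 := by
    rw [l2norm, Real.sq_sqrt (Finset.sum_nonneg fun _ _ => sq_nonneg _)]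
    simp [dotProduct, sq]
  have h5 : l2norm (LN x - LN y) ^ 2 ≤ l2norm (x - y) * l2norm (LN x - LN y) := by
    rw [← h4]
    simp only [sub_dotProduct, dotProduct_sub] at *
    have := dotProduct_comm (LN x) (LN y)
    linarith
  nlinarith [l2norm_nonneg (LN x - LN y), l2norm_nonneg (x - y)]

lemma exp_sub_one_le {t : ℝ} (ht : 0 ≤ t) : Real.exp t - 1 ≤ t / 2 * (Real.exp t + 1) := by
  have hd : ∀ x : ℝ, HasDerivAt (fun t => t / 2 * (Real.exp t + 1) - (Real.exp t - 1))
      ((1 / 2) * (Real.exp x + 1) + x / 2 * Real.exp x - Real.exp x) x := fun x =>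
    (((hasDerivAt_id x).div_const 2).mul ((Real.hasDerivAt_exp x).add_const 1)).sub
      ((Real.hasDerivAt_exp x).sub_const 1)
  have hmono : Monotone (fun t => t / 2 * (Real.exp t + 1) - (Real.exp t - 1)) := by
    refine monotone_of_hasDerivAt_nonneg hd fun x => ?_
    have h1 := Real.add_one_le_exp (-x)
    have h2 : Real.exp (-x) * Real.exp x = 1 := by rw [← Real.exp_add]; simp
    have h3 := mul_le_mul_of_nonneg_right h1 (Real.exp_pos x).le
    simp only [Pi.zero_apply]
    linarith
  have := hmono ht
  simp at this
  linarith

lemma abs_exp_sub_exp_le (a b : ℝ) :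
    |Real.exp a - Real.exp b| ≤ |a - b| / 2 * (Real.exp a + Real.exp b) := by
  wlog hab : b ≤ a generalizing a b
  · rw [abs_sub_comm, abs_sub_comm a b, add_comm]
    exact this b a (le_of_not_ge hab)
  have h := mul_le_mul_of_nonneg_right (exp_sub_one_le (sub_nonneg.2 hab)) (Real.exp_pos b).le
  have h2 : Real.exp (a - b) * Real.exp b = Real.exp a := by rw [← Real.exp_add]; simp
  rw [abs_of_nonneg (sub_nonneg.2 (Real.exp_le_exp.2 hab)), abs_of_nonneg (sub_nonneg.2 hab)]
  calc Real.exp a - Real.exp b = (Real.exp (a - b) - 1) * Real.exp b := by rw [sub_mul, h2, one_mul]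
    _ ≤ _ := h
    _ = _ := by rw [mul_assoc, add_mul, h2, one_mul]

/-- The softmax of `u` restricted to `S`, extended by zero. -/
noncomputable def softmaxOn {ι : Type*} [DecidableEq ι] (S : Finset ι) (u : ι → ℝ) (j : ι) : ℝ :=
  if j ∈ S then Real.exp (u j) / ∑ k ∈ S, Real.exp (u k) else 0

lemma softmaxOn_nonneg {ι : Type*} [DecidableEq ι] (S : Finset ι) (u : ι → ℝ) (j : ι) :
    0 ≤ softmaxOn S u j := by
  unfold softmaxOn
  positivity

lemma sum_exp_pos {ι : Type*} {S : Finset ι} (hS : S.Nonempty) (u : ι → ℝ) :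
    0 < ∑ k ∈ S, Real.exp (u k) :=
  Finset.sum_pos (fun _ _ => Real.exp_pos _) hS

lemma sum_softmaxOn_self {ι : Type*} [DecidableEq ι] {S : Finset ι} (hS : S.Nonempty)
    (u : ι → ℝ) : ∑ j ∈ S, softmaxOn S u j = 1 := by
  have h : ∀ j ∈ S, softmaxOn S u j = Real.exp (u j) / ∑ k ∈ S, Real.exp (u k) :=
    fun j hj => if_pos hj
  rw [Finset.sum_congr rfl h, ← Finset.sum_div, div_self (sum_exp_pos hS u).ne']

lemma sum_softmaxOn {ι : Type*} [Fintype ι] [DecidableEq ι] {S : Finset ι} (hS : S.Nonempty)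
    (u : ι → ℝ) : ∑ j, softmaxOn S u j = 1 := by
  rw [← sum_softmaxOn_self hS u]
  exact (Finset.sum_subset (Finset.subset_univ S) fun j _ hj => if_neg hj).symm

/-- Restricted softmax is `2`-Lipschitz from the sup norm to the `ℓ¹` norm. -/
lemma sum_abs_softmaxOn_sub_le {ι : Type*} [Fintype ι] [DecidableEq ι] {S : Finset ι}
    (hS : S.Nonempty) (u v : ι → ℝ) {ε : ℝ} (huv : ∀ j, |u j - v j| ≤ ε) :
    ∑ j, |softmaxOn S u j - softmaxOn S v j| ≤ 2 * ε := by
  have hU := sum_exp_pos hS u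
  have hV := sum_exp_pos hS v
  have hpair : ∀ j k, |softmaxOn S u j * softmaxOn S v k - softmaxOn S u k * softmaxOn S v j| ≤
      ε * (softmaxOn S u j * softmaxOn S v k + softmaxOn S u k * softmaxOn S v j) := by
    intro j k
    by_cases hj : j ∈ S
    · by_cases hk : k ∈ S
      · simp only [softmaxOn, hj, hk, if_true]
        have key := abs_exp_sub_exp_le (u j + v k) (u k + v j)
        have hε : |u j + v k - (u k + v j)| / 2 ≤ ε := by
          have h1 := abs_le.1 (huv j)
          have h2 := abs_le.1 (huv k)
          have : |u j + v k - (u k + v j)| ≤ 2 * ε := abs_le.2 ⟨by linarith, by linarith⟩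
          linarith
        have key2 := key.trans (mul_le_mul_of_nonneg_right hε (by positivity))
        simp only [Real.exp_add] at key2
        rw [div_mul_div_comm, div_mul_div_comm, ← sub_div, ← add_div, abs_div,
          abs_of_pos (mul_pos hU hV), ← mul_div_assoc]
        exact div_le_div_of_nonneg_right key2 (mul_pos hU hV).le
      · simp [softmaxOn, hk]
    · simp [softmaxOn, hj]
  have hexpand : ∀ j, softmaxOn S u j - softmaxOn S v j =
      ∑ k, (softmaxOn S u j * softmaxOn S v k - softmaxOn S u k * softmaxOn S v j) := by
    intro j
    rw [Finset.sum_sub_distrib, ← Finset.mul_sum, ← Finset.sum_mul, sum_softmaxOn hS,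
      sum_softmaxOn hS, mul_one, one_mul]
  calc ∑ j, |softmaxOn S u j - softmaxOn S v j|
      ≤ ∑ j, ∑ k, ε * (softmaxOn S u j * softmaxOn S v k + softmaxOn S u k * softmaxOn S v j) := by
        refine Finset.sum_le_sum fun j _ => ?_
        rw [hexpand]
        exact (Finset.abs_sum_le_sum_abs _ _).trans (Finset.sum_le_sum fun k _ => hpair j k)
    _ = 2 * ε := by
        simp only [← Finset.mul_sum, Finset.sum_add_distrib, ← Finset.sum_mul, sum_softmaxOn hS]
        ring

/-- Discarding `T` and renormalizing moves the softmax by at most twice the discarded mass. -/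
lemma sum_abs_softmaxOn_sdiff_sub_le {ι : Type*} [Fintype ι] [DecidableEq ι] {S T : Finset ι}
    (hTS : T ⊆ S) (u : ι → ℝ) :
    ∑ j, |softmaxOn (S \ T) u j - softmaxOn S u j| ≤ 2 * ∑ j ∈ T, softmaxOn S u j := by
  have hsplit : ∑ j, |softmaxOn (S \ T) u j - softmaxOn S u j| =
      ∑ j ∈ S \ T, |softmaxOn (S \ T) u j - softmaxOn S u j| + ∑ j ∈ T, softmaxOn S u j := by
    rw [← Finset.sum_subset (Finset.subset_univ S), ← Finset.sum_sdiff hTS]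
    · congr 1
      refine Finset.sum_congr rfl fun j hj => ?_
      have : softmaxOn (S \ T) u j = 0 := if_neg fun h => (Finset.mem_sdiff.1 h).2 hj
      rw [this, zero_sub, abs_neg, abs_of_nonneg (softmaxOn_nonneg S u j)]
    · intro j _ hj
      simp [softmaxOn, hj]
  rw [hsplit, two_mul]
  gcongr
  rcases (S \ T).eq_empty_or_nonempty with h | h
  · rw [h, Finset.sum_empty]
    exact Finset.sum_nonneg fun j _ => softmaxOn_nonneg S u j
  · have hS : S.Nonempty := h.mono Finset.sdiff_subset
    have hmono : ∀ j ∈ S \ T, softmaxOn S u j ≤ softmaxOn (S \ T) u j := by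
      intro j hj
      rw [softmaxOn, softmaxOn, if_pos hj, if_pos (Finset.sdiff_subset hj)]
      exact div_le_div_of_nonneg_left (Real.exp_pos _).le (sum_exp_pos h u)
        (Finset.sum_le_sum_of_subset_of_nonneg Finset.sdiff_subset
          fun _ _ _ => (Real.exp_pos _).le)
    rw [Finset.sum_congr rfl fun j hj => abs_of_nonneg (sub_nonneg.2 (hmono j hj)),
      Finset.sum_sub_distrib, sum_softmaxOn_self h]
    have := Finset.sum_sdiff hTS (f := softmaxOn S u)
    rw [sum_softmaxOn_self hS] at this
    linarith

lemma causalAttn_eq_softmaxOn {N d dk : ℕ} (X : Matrix (Fin N) (Fin d) ℝ)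
    (WQ WK : Matrix (Fin d) (Fin dk) ℝ) (i : Fin N) :
    causalAttn X WQ WK i =
      softmaxOn (Finset.univ.filter (· ≤ i)) ((X * WQ * (X * WK)ᵀ) i) := by
  ext j
  simp [causalAttn, softmaxOn]

lemma lazyAttn_eq_softmaxOn {N d dk : ℕ} (X : Matrix (Fin N) (Fin d) ℝ)
    (WQ WK : Matrix (Fin d) (Fin dk) ℝ) (M : Fin N → Finset (Fin N)) (i : Fin N) :
    lazyAttn X WQ WK M i =
      softmaxOn (Finset.univ.filter (· ≤ i) \ M i) ((X * WQ * (X * WK)ᵀ) i) := by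
  have h : Finset.univ.filter (· ≤ i) \ M i =
      Finset.univ.filter (fun k : Fin N => k ≤ i ∧ k ∉ M i) := by
    ext k
    simp
  ext j
  simp [lazyAttn, softmaxOn, h]

lemma abs_scores_sub_le {N d dk : ℕ} {B δ : ℝ} {WQ WK : Matrix (Fin d) (Fin dk) ℝ}
    (hWQ : frobNorm WQ ≤ B) (hWK : frobNorm WK ≤ B) {Y Y' : Matrix (Fin N) (Fin d) ℝ}
    (hY : ∀ i, l2norm (Y i) ≤ 1) (hY' : ∀ i, l2norm (Y' i) ≤ 1)
    (hYY : ∀ i, l2norm (Y' i - Y i) ≤ δ) (i j : Fin N) :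
    |(Y' * WQ * (Y' * WK)ᵀ) i j - (Y * WQ * (Y * WK)ᵀ) i j| ≤ 2 * B ^ 2 * δ := by
  have hB : 0 ≤ B := (Real.sqrt_nonneg _).trans hWQ
  have hδ : 0 ≤ δ := (l2norm_nonneg _).trans (hYY i)
  have hrow : ∀ (Z : Matrix (Fin N) (Fin d) ℝ),
      (Z * WQ * (Z * WK)ᵀ) i j = (Z i ᵥ* WQ) ⬝ᵥ (Z j ᵥ* WK) := fun Z => rfl
  have hmul : ∀ (x : Fin d → ℝ) (W : Matrix (Fin d) (Fin dk) ℝ) (r : ℝ), l2norm x ≤ r →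
      frobNorm W ≤ B → l2norm (x ᵥ* W) ≤ r * B := fun x W r hx hW =>
    (l2norm_vecMul_le x W).trans
      (mul_le_mul hx hW (Real.sqrt_nonneg _) ((l2norm_nonneg x).trans hx))
  have hdecomp : (Y' i ᵥ* WQ) ⬝ᵥ (Y' j ᵥ* WK) - (Y i ᵥ* WQ) ⬝ᵥ (Y j ᵥ* WK) =
      ((Y' i - Y i) ᵥ* WQ) ⬝ᵥ (Y' j ᵥ* WK) + (Y i ᵥ* WQ) ⬝ᵥ ((Y' j - Y j) ᵥ* WK) := by
    simp only [Matrix.sub_vecMul, sub_dotProduct, dotProduct_sub]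
    ring
  rw [hrow, hrow, hdecomp]
  refine (abs_add_le _ _).trans ?_
  have h1 := (abs_dotProduct_le ((Y' i - Y i) ᵥ* WQ) (Y' j ᵥ* WK)).trans
    (mul_le_mul (hmul _ _ _ (hYY i) hWQ) (hmul _ _ _ (hY' j) hWK) (l2norm_nonneg _)
      (by positivity))
  have h2 := (abs_dotProduct_le (Y i ᵥ* WQ) ((Y' j - Y j) ᵥ* WK)).trans
    (mul_le_mul (hmul _ _ _ (hY i) hWQ) (hmul _ _ _ (hYY j) hWK) (l2norm_nonneg _)
      (by positivity))
  linarith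

lemma l2norm_head_sub_le {N d dk : ℕ} {B δ : ℝ} {WQ WK : Matrix (Fin d) (Fin dk) ℝ}
    {WV : Matrix (Fin d) (Fin d) ℝ} (hWQ : frobNorm WQ ≤ B) (hWK : frobNorm WK ≤ B)
    (hWV : frobNorm WV ≤ B) {M : Fin N → Finset (Fin N)} (hM : ∀ i : Fin N, ∀ j ∈ M i, j ≤ i)
    {Y Y' : Matrix (Fin N) (Fin d) ℝ} (hY : ∀ i, l2norm (Y i) ≤ 1)
    (hY' : ∀ i, l2norm (Y' i) ≤ 1) (hYY : ∀ i, l2norm (Y' i - Y i) ≤ δ) (i : Fin N) :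
    l2norm ((lazyAttn Y' WQ WK M * Y' * WV) i - (causalAttn Y WQ WK * Y * WV) i) ≤
      (2 * ∑ j ∈ M i, causalAttn Y' WQ WK i j + (1 + 4 * B ^ 2) * δ) * B := by
  have hrow : ∀ (A : Matrix (Fin N) (Fin N) ℝ) (Z : Matrix (Fin N) (Fin d) ℝ),
      (A * Z * WV) i = (A i ᵥ* Z) ᵥ* WV := fun A Z => rfl
  have hdecomp : (lazyAttn Y' WQ WK M * Y' * WV) i - (causalAttn Y WQ WK * Y * WV) i =
      ((lazyAttn Y' WQ WK M i - causalAttn Y' WQ WK i) ᵥ* Y' +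
        ((causalAttn Y' WQ WK i - causalAttn Y WQ WK i) ᵥ* Y' +
          causalAttn Y WQ WK i ᵥ* (Y' - Y))) ᵥ* WV := by
    rw [hrow, hrow, ← Matrix.sub_vecMul]
    congr 1
    simp only [Matrix.sub_vecMul, Matrix.vecMul_sub]
    abel
  have hne : (Finset.univ.filter (· ≤ i)).Nonempty := ⟨i, by simp⟩
  have hsub : M i ⊆ Finset.univ.filter (· ≤ i) := fun j hj => by simpa using hM i j hj
  have h1 := l2norm_vecMul_le_of_rows (lazyAttn Y' WQ WK M i - causalAttn Y' WQ WK i) Y' hY'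
  have h2 := l2norm_vecMul_le_of_rows (causalAttn Y' WQ WK i - causalAttn Y WQ WK i) Y' hY'
  have h3 := l2norm_vecMul_le_of_rows (causalAttn Y WQ WK i) (Y' - Y) hYY
  have hlazy : ∑ j, |(lazyAttn Y' WQ WK M i - causalAttn Y' WQ WK i) j| ≤
      2 * ∑ j ∈ M i, causalAttn Y' WQ WK i j := by
    rw [lazyAttn_eq_softmaxOn, causalAttn_eq_softmaxOn]
    exact sum_abs_softmaxOn_sdiff_sub_le hsub _
  have hscore : ∑ j, |(causalAttn Y' WQ WK i - causalAttn Y WQ WK i) j| ≤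
      2 * (2 * B ^ 2 * δ) := by
    rw [causalAttn_eq_softmaxOn, causalAttn_eq_softmaxOn]
    exact sum_abs_softmaxOn_sub_le hne _ _ fun j => abs_scores_sub_le hWQ hWK hY hY' hYY i j
  have hone : ∑ j, |causalAttn Y WQ WK i j| = 1 := by
    rw [causalAttn_eq_softmaxOn, ← sum_softmaxOn hne ((Y * WQ * (Y * WK)ᵀ) i)]
    exact Finset.sum_congr rfl fun j _ => abs_of_nonneg (softmaxOn_nonneg _ _ _)
  rw [hone] at h3
  rw [hdecomp]
  have hsum : l2norm ((lazyAttn Y' WQ WK M i - causalAttn Y' WQ WK i) ᵥ* Y' +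
        ((causalAttn Y' WQ WK i - causalAttn Y WQ WK i) ᵥ* Y' +
          causalAttn Y WQ WK i ᵥ* (Y' - Y))) ≤
      2 * ∑ j ∈ M i, causalAttn Y' WQ WK i j + (1 + 4 * B ^ 2) * δ := by
    refine (l2norm_add_le _ _).trans ?_
    have := l2norm_add_le ((causalAttn Y' WQ WK i - causalAttn Y WQ WK i) ᵥ* Y')
      (causalAttn Y WQ WK i ᵥ* (Y' - Y))
    linarith
  exact (l2norm_vecMul_le _ _).trans
    (mul_le_mul hsum hWV (Real.sqrt_nonneg _) ((l2norm_nonneg _).trans hsum))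

/-- `‖mha~(LN(X̃)) − mha(LN(X))‖_{2,∞}
      ≤ H B (1 + 4 B²) min{2, ‖X − X̃‖_{2,∞}} + 2 B H s`. -/
theorem lazy_mha_LN_error {H N d dk : ℕ} (B : ℝ) (hB : 0 < B)
    (WQ WK : Fin H → Matrix (Fin d) (Fin dk) ℝ)
    (WV : Fin H → Matrix (Fin d) (Fin d) ℝ)
    (hWQ : ∀ h, frobNorm (WQ h) ≤ B)
    (hWK : ∀ h, frobNorm (WK h) ≤ B)
    (hWV : ∀ h, frobNorm (WV h) ≤ B)
    (M : Fin N → Finset (Fin N)) (hM : ∀ i : Fin N, ∀ j ∈ M i, j ≤ i)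
    (X X' : Matrix (Fin N) (Fin d) ℝ)
    (s : ℝ)
    (hs : s = ⨆ i : Fin N,
      (1 / (H : ℝ)) * ∑ h, ∑ j ∈ M i, causalAttn (matLN X') (WQ h) (WK h) i j) :
    norm2inf (lazyMha (matLN X') WQ WK WV M - mha (matLN X) WQ WK WV) ≤
      H * B * (1 + 4 * B ^ 2) * min 2 (norm2inf (X - X')) + 2 * B * H * s := by
  have hX : ∀ i, l2norm (matLN X i) ≤ 1 := fun i => l2norm_LN_le_one (X i)
  have hX' : ∀ i, l2norm (matLN X' i) ≤ 1 := fun i => l2norm_LN_le_one (X' i)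
  have hYY : ∀ i, l2norm (matLN X' i - matLN X i) ≤ min 2 (norm2inf (X - X')) := by
    intro i
    refine le_min ?_ ?_
    · exact (l2norm_sub_le _ _).trans ((add_le_add (hX' i) (hX i)).trans (by norm_num))
    · rw [l2norm_sub_comm]
      exact (l2norm_LN_sub_LN_le (X i) (X' i)).trans (l2norm_row_le_norm2inf (X - X') i)
  have hmass : ∀ i : Fin N,
      0 ≤ ∑ h, ∑ j ∈ M i, causalAttn (matLN X') (WQ h) (WK h) i j := fun i =>
    Finset.sum_nonneg fun h _ => Finset.sum_nonneg fun j _ => by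
      rw [causalAttn_eq_softmaxOn]
      exact softmaxOn_nonneg _ _ _
  have hs0 : 0 ≤ s := by
    rw [hs]
    exact Real.iSup_nonneg fun i => mul_nonneg (by positivity) (hmass i)
  have hδ : 0 ≤ min 2 (norm2inf (X - X')) :=
    le_min (by norm_num) (Real.iSup_nonneg fun i => l2norm_nonneg _)
  refine Real.iSup_le (fun i => ?_) (by positivity)
  have hsi : ∑ h, ∑ j ∈ M i, causalAttn (matLN X') (WQ h) (WK h) i j ≤ H * s := by
    rcases Nat.eq_zero_or_pos H with rfl | hH
    · simp
    · have hle := le_ciSup (f := fun i : Fin N => (1 / (H : ℝ)) *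
        ∑ h, ∑ j ∈ M i, causalAttn (matLN X') (WQ h) (WK h) i j) (Set.finite_range _).bddAbove i
      rw [← hs] at hle
      have hH' : (0 : ℝ) < H := by exact_mod_cast hH
      rw [one_div, inv_mul_le_iff₀ hH'] at hle
      exact hle
  have hrow : (lazyMha (matLN X') WQ WK WV M - mha (matLN X) WQ WK WV) i =
      ∑ h, ((lazyAttn (matLN X') (WQ h) (WK h) M * matLN X' * WV h) i -
        (causalAttn (matLN X) (WQ h) (WK h) * matLN X * WV h) i) := by
    ext j
    simp [lazyMha, mha, Matrix.sum_apply]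
  rw [hrow]
  refine (l2norm_sum_le _ _).trans ((Finset.sum_le_sum fun h _ =>
    l2norm_head_sub_le (hWQ h) (hWK h) (hWV h) hM hX hX' hYY i).trans ?_)
  rw [← Finset.sum_mul, Finset.sum_add_distrib, ← Finset.mul_sum, Finset.sum_const,
    Finset.card_univ, Fintype.card_fin, nsmul_eq_mul]
  have := mul_le_mul_of_nonneg_right hsi hB.le
  linarith
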